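/- For Full Modal Team Logic formulas φ₁, φ₂, the existential bisimulation quantifier satisfies: ∃̃p (φ₁ ∧ NE) ≡ (∃̃p φ₁) ∧ NE; ∃̃p (φ₁ ∨ φ₂) ≡ ∃̃p φ₁ ∨ ∃̃p φ₂; and ∃̃p (φ₁ ⊗ φ₂) ≡ ∃̃p φ₁ ⊗ ∃̃p φ₂ (equivalence meaning satisfaction by exactly the same team models). -/

import Mathlib

/-- A Kripke model `M = (W, R, V)` over a set `V` of propositional letters. -/
structure KModel (V : Type) : Type 1 where
  W : Type
  R : W → W → Prop
  val : W → V → Prop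

variable {V : Type}

/-- `B` is a `P`-bisimulation between the Kripke models `M` and `N`:
related points agree on all propositions of `P`, and `B` satisfies the
forth and back conditions. -/
def IsBisim (P : Set V) (M N : KModel V) (B : M.W → N.W → Prop) : Prop :=
  (∀ w v, B w v → ∀ p ∈ P, (M.val w p ↔ N.val v p)) ∧
  (∀ w v, B w v → ∀ w', M.R w w' → ∃ v', N.R v v' ∧ B w' v') ∧
  (∀ w v, B w v → ∀ v', N.R v v' → ∃ w', M.R w w' ∧ B w' v')

/-- `(M,w) ⇌_P (N,v)`: some `P`-bisimulation relates `w` and `v`. -/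
def Bisimilar (P : Set V) (M : KModel V) (w : M.W) (N : KModel V) (v : N.W) : Prop :=
  ∃ B, IsBisim P M N B ∧ B w v

/-- Team `P`-bisimulation `(M,X) ⇌_P (N,Y)`: every point of `X` is
`P`-bisimilar to some point of `Y` and conversely. -/
def TeamBisim (P : Set V) (M : KModel V) (X : Set M.W) (N : KModel V) (Y : Set N.W) : Prop :=
  (∀ x ∈ X, ∃ y ∈ Y, Bisimilar P M x N y) ∧
  (∀ y ∈ Y, ∃ x ∈ X, Bisimilar P M x N y)

/-- Formulas of Full Modal Team Logic: literals, `⊥`, `NE`, `∧`, `⊗`, `∨`,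
`◇`, `□`. -/
inductive MForm (V : Type) : Type where
  | var : V → MForm V
  | nvar : V → MForm V
  | bot : MForm V
  | ne : MForm V
  | and : MForm V → MForm V → MForm V
  | tens : MForm V → MForm V → MForm V
  | or : MForm V → MForm V → MForm V
  | dia : MForm V → MForm V
  | box : MForm V → MForm V

/-- `R(X) = {t : ∃ s ∈ X, sRt}`. -/
def KModel.img (M : KModel V) (X : Set M.W) : Set M.W := {t | ∃ s ∈ X, M.R s t}

/-- `X R Y`: every point of `X` has an `R`-successor in `Y` and every point
of `Y` has an `R`-predecessor in `X`. -/
def teamR (M : KModel V) (X Y : Set M.W) : Prop :=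
  (∀ x ∈ X, ∃ y ∈ Y, M.R x y) ∧ (∀ y ∈ Y, ∃ x ∈ X, M.R x y)

/-- Modal team semantics of Full Modal Team Logic. -/
def MSat (M : KModel V) : Set M.W → MForm V → Prop
  | X, .var p => ∀ s ∈ X, M.val s p
  | X, .nvar p => ∀ s ∈ X, ¬ M.val s p
  | X, .bot => X = ∅
  | X, .ne => X ≠ ∅
  | X, .and φ ψ => MSat M X φ ∧ MSat M X ψ
  | X, .tens φ ψ => ∃ X₁ X₂, X = X₁ ∪ X₂ ∧ MSat M X₁ φ ∧ MSat M X₂ ψ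
  | X, .or φ ψ => MSat M X φ ∨ MSat M X ψ
  | X, .dia φ => ∃ Y, teamR M X Y ∧ MSat M Y φ
  | X, .box φ => MSat M (M.img X) φ

/-- The set `L(φ)` of propositional letters occurring in `φ` (these are
exactly the free variables of an `FMTL` formula). -/
def mletters : MForm V → Set V
  | .var p => {p}
  | .nvar p => {p}
  | .bot => ∅
  | .ne => ∅
  | .and φ ψ => mletters φ ∪ mletters ψ
  | .tens φ ψ => mletters φ ∪ mletters ψ
  | .or φ ψ => mletters φ ∪ mletters ψ
  | .dia φ => mletters φ
  | .box φ => mletters φ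

/-- `(M,X) ⊨ ∃̃p φ`: there is `(M',X')` with
`(M',X') ⇌_{L(φ)\{p}} (M,X)` and `(M',X') ⊨ φ` (for `FMTL` formulas the
free variables are exactly the occurring letters). -/
def exqSat (p : V) (φ : MForm V) (M : KModel V) (X : Set M.W) : Prop :=
  ∃ (M' : KModel V) (X' : Set M'.W),
    TeamBisim (mletters φ \ {p}) M' X' M X ∧ MSat M' X' φ

namespace Bisimilar

variable {P Q : Set V} {M N K : KModel V} {w : M.W} {v : N.W} {u : K.W}

theorem mono (hPQ : P ⊆ Q) : Bisimilar Q M w N v → Bisimilar P M w N v := by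
  rintro ⟨B, ⟨ha, hf, hb⟩, h⟩
  exact ⟨B, ⟨fun x y hxy p hp => ha x y hxy p (hPQ hp), hf, hb⟩, h⟩

theorem symm : Bisimilar P M w N v → Bisimilar P N v M w := by
  rintro ⟨B, ⟨ha, hf, hb⟩, h⟩
  exact ⟨fun y x => B x y, ⟨fun y x hxy p hp => (ha x y hxy p hp).symm,
    fun y x hxy => hb x y hxy, fun y x hxy => hf x y hxy⟩, h⟩

theorem trans : Bisimilar P M w N v → Bisimilar P N v K u → Bisimilar P M w K u := by
  rintro ⟨B, ⟨ha, hf, hb⟩, h⟩ ⟨C, ⟨ha', hf', hb'⟩, h'⟩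
  refine ⟨fun x z => ∃ y, B x y ∧ C y z, ⟨?_, ?_, ?_⟩, v, h, h'⟩
  · rintro x z ⟨y, hxy, hyz⟩ p hp
    exact (ha x y hxy p hp).trans (ha' y z hyz p hp)
  · rintro x z ⟨y, hxy, hyz⟩ x' hx'
    obtain ⟨y', hy', hxy'⟩ := hf x y hxy x' hx'
    obtain ⟨z', hz', hyz'⟩ := hf' y z hyz y' hy'
    exact ⟨z', hz', y', hxy', hyz'⟩
  · rintro x z ⟨y, hxy, hyz⟩ z' hz'
    obtain ⟨y', hy', hyz'⟩ := hb' y z hyz z' hz'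
    obtain ⟨x', hx', hxy'⟩ := hb x y hxy y' hy'
    exact ⟨x', hx', y', hxy', hyz'⟩

theorem val_iff (h : Bisimilar P M w N v) {p : V} (hp : p ∈ P) : M.val w p ↔ N.val v p := by
  obtain ⟨B, hB, h⟩ := h
  exact hB.1 w v h p hp

theorem forth (h : Bisimilar P M w N v) {w' : M.W} (hw' : M.R w w') :
    ∃ v', N.R v v' ∧ Bisimilar P M w' N v' := by
  obtain ⟨B, hB, h⟩ := h
  obtain ⟨v', hv', h'⟩ := hB.2.1 w v h w' hw'
  exact ⟨v', hv', B, hB, h'⟩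

theorem back (h : Bisimilar P M w N v) {v' : N.W} (hv' : N.R v v') :
    ∃ w', M.R w w' ∧ Bisimilar P M w' N v' := by
  obtain ⟨w', hw', h'⟩ := h.symm.forth hv'
  exact ⟨w', hw', h'.symm⟩

/-- A bounded morphism relates every point to a bisimilar one. -/
theorem of_map (f : M.W → N.W) (hval : ∀ x, ∀ p ∈ P, (M.val x p ↔ N.val (f x) p))
    (hforth : ∀ x x', M.R x x' → N.R (f x) (f x'))
    (hback : ∀ x y, N.R (f x) y → ∃ x', M.R x x' ∧ f x' = y) (x : M.W) :
    Bisimilar P M x N (f x) := by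
  refine ⟨fun x y => f x = y, ⟨?_, ?_, ?_⟩, rfl⟩
  · rintro x _ rfl
    exact hval x
  · rintro x _ rfl x' hx'
    exact ⟨f x', hforth x x' hx', rfl⟩
  · rintro x _ rfl y hy
    exact hback x y hy

end Bisimilar

namespace TeamBisim

variable {P Q : Set V} {M N : KModel V} {X : Set M.W} {Y : Set N.W}

theorem mono (hPQ : P ⊆ Q) (h : TeamBisim Q M X N Y) : TeamBisim P M X N Y := by
  refine ⟨fun x hx => ?_, fun y hy => ?_⟩
  · obtain ⟨y, hy, hxy⟩ := h.1 x hx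
    exact ⟨y, hy, hxy.mono hPQ⟩
  · obtain ⟨x, hx, hxy⟩ := h.2 y hy
    exact ⟨x, hx, hxy.mono hPQ⟩

theorem image {f : M.W → N.W} (hf : ∀ x, Bisimilar P M x N (f x)) (X : Set M.W) :
    TeamBisim P M X N (f '' X) := by
  refine ⟨fun x hx => ⟨f x, ⟨x, hx, rfl⟩, hf x⟩, ?_⟩
  rintro _ ⟨x, hx, rfl⟩
  exact ⟨x, hx, hf x⟩

theorem eq_empty_iff (h : TeamBisim P M X N Y) : X = ∅ ↔ Y = ∅ := by
  constructor
  · rintro rfl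
    refine Set.eq_empty_of_forall_notMem fun y hy => ?_
    obtain ⟨x, hx, -⟩ := h.2 y hy
    exact hx
  · rintro rfl
    refine Set.eq_empty_of_forall_notMem fun x hx => ?_
    obtain ⟨y, hy, -⟩ := h.1 x hx
    exact hy

/-- A splitting of one of two bisimilar teams induces a splitting of the other. -/
theorem exists_union {X₁ X₂ : Set M.W} (h : TeamBisim P M (X₁ ∪ X₂) N Y) :
    ∃ Y₁ Y₂, Y = Y₁ ∪ Y₂ ∧ TeamBisim P M X₁ N Y₁ ∧ TeamBisim P M X₂ N Y₂ := by
  refine ⟨{y ∈ Y | ∃ x ∈ X₁, Bisimilar P M x N y}, {y ∈ Y | ∃ x ∈ X₂, Bisimilar P M x N y},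
    ?_, ⟨fun x hx => ?_, fun y hy => hy.2⟩, ⟨fun x hx => ?_, fun y hy => hy.2⟩⟩
  · ext y
    constructor
    · intro hy
      obtain ⟨x, hx | hx, hxy⟩ := h.2 y hy
      · exact Or.inl ⟨hy, x, hx, hxy⟩
      · exact Or.inr ⟨hy, x, hx, hxy⟩
    · rintro (hy | hy) <;> exact hy.1
  · obtain ⟨y, hy, hxy⟩ := h.1 x (Or.inl hx)
    exact ⟨y, ⟨hy, x, hx, hxy⟩, hxy⟩
  · obtain ⟨y, hy, hxy⟩ := h.1 x (Or.inr hx)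
    exact ⟨y, ⟨hy, x, hx, hxy⟩, hxy⟩

theorem img (h : TeamBisim P M X N Y) : TeamBisim P M (M.img X) N (N.img Y) := by
  constructor
  · rintro x' ⟨x, hx, hxx'⟩
    obtain ⟨y, hy, hxy⟩ := h.1 x hx
    obtain ⟨y', hyy', hxy'⟩ := hxy.forth hxx'
    exact ⟨y', ⟨y, hy, hyy'⟩, hxy'⟩
  · rintro y' ⟨y, hy, hyy'⟩
    obtain ⟨x, hx, hxy⟩ := h.2 y hy
    obtain ⟨x', hxx', hxy'⟩ := hxy.back hyy'
    exact ⟨x', ⟨x, hx, hxx'⟩, hxy'⟩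

theorem exists_teamR (h : TeamBisim P M X N Y) {X' : Set M.W} (hX : teamR M X X') :
    ∃ Y', teamR N Y Y' ∧ TeamBisim P M X' N Y' := by
  refine ⟨{y' ∈ N.img Y | ∃ x' ∈ X', Bisimilar P M x' N y'},
    ⟨fun y hy => ?_, fun y' hy' => hy'.1⟩, fun x' hx' => ?_, fun y' hy' => hy'.2⟩
  · obtain ⟨x, hx, hxy⟩ := h.2 y hy
    obtain ⟨x', hx', hxx'⟩ := hX.1 x hx
    obtain ⟨y', hyy', hxy'⟩ := hxy.forth hxx'
    exact ⟨y', ⟨⟨y, hy, hyy'⟩, x', hx', hxy'⟩, hyy'⟩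
  · obtain ⟨x, hx, hxx'⟩ := hX.2 x' hx'
    obtain ⟨y, hy, hxy⟩ := h.1 x hx
    obtain ⟨y', hyy', hxy'⟩ := hxy.forth hxx'
    exact ⟨y', ⟨⟨y, hy, hyy'⟩, x', hx', hxy'⟩, hxy'⟩

end TeamBisim

/-- Satisfaction is invariant under team bisimulation for the occurring letters. -/
theorem MSat.of_teamBisim {P : Set V} {M N : KModel V} {φ : MForm V} (hφ : mletters φ ⊆ P)
    {X : Set M.W} {Y : Set N.W} (h : TeamBisim P M X N Y) (hX : MSat M X φ) : MSat N Y φ := by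
  induction φ generalizing X Y with
  | var p =>
    intro y hy
    obtain ⟨x, hx, hxy⟩ := h.2 y hy
    exact (hxy.val_iff (hφ rfl)).1 (hX x hx)
  | nvar p =>
    intro y hy
    obtain ⟨x, hx, hxy⟩ := h.2 y hy
    exact fun hp => hX x hx ((hxy.val_iff (hφ rfl)).2 hp)
  | bot => exact h.eq_empty_iff.1 hX
  | ne => exact mt h.eq_empty_iff.2 hX
  | and φ ψ ihφ ihψ =>
    obtain ⟨hφ, hψ⟩ := Set.union_subset_iff.1 hφ
    exact ⟨ihφ hφ h hX.1, ihψ hψ h hX.2⟩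
  | tens φ ψ ihφ ihψ =>
    obtain ⟨hφ, hψ⟩ := Set.union_subset_iff.1 hφ
    obtain ⟨X₁, X₂, rfl, h₁, h₂⟩ := hX
    obtain ⟨Y₁, Y₂, rfl, hY₁, hY₂⟩ := h.exists_union
    exact ⟨Y₁, Y₂, rfl, ihφ hφ hY₁ h₁, ihψ hψ hY₂ h₂⟩
  | or φ ψ ihφ ihψ =>
    obtain ⟨hφ, hψ⟩ := Set.union_subset_iff.1 hφ
    exact hX.imp (ihφ hφ h) (ihψ hψ h)
  | dia φ ih =>
    obtain ⟨X', hXX', hX'⟩ := hX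
    obtain ⟨Y', hYY', hY'⟩ := h.exists_teamR hXX'
    exact ⟨Y', hYY', ih hφ hY' hX'⟩
  | box φ ih => exact ih hφ h.img hX

/-- The model on pairs of `P \ {p}`-bisimilar points that takes the letters of `P` from the first
component and all other letters from the second. -/
def KModel.amalgam (P : Set V) (p : V) (M N : KModel V) : KModel V where
  W := {x : M.W × N.W // Bisimilar (P \ {p}) M x.1 N x.2}
  R x y := M.R x.1.1 y.1.1 ∧ N.R x.1.2 y.1.2
  val x q := (q ∈ P ∧ M.val x.1.1 q) ∨ (q ∉ P ∧ N.val x.1.2 q)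

theorem bisimilar_amalgam_fst (P : Set V) (p : V) (M N : KModel V)
    (x : (KModel.amalgam P p M N).W) :
    Bisimilar P (KModel.amalgam P p M N) x M x.1.1 := by
  refine Bisimilar.of_map (fun x : (KModel.amalgam P p M N).W => x.1.1) ?_ ?_ ?_ x
  · intro x q hq
    simp [KModel.amalgam, hq]
  · exact fun x x' h => h.1
  · intro x y hy
    obtain ⟨v, hv, hyv⟩ := x.2.forth hy
    exact ⟨⟨(y, v), hyv⟩, ⟨hy, hv⟩, rfl⟩

theorem bisimilar_amalgam_snd (P : Set V) (p : V) (M N : KModel V)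
    (x : (KModel.amalgam P p M N).W) :
    Bisimilar {p}ᶜ (KModel.amalgam P p M N) x N x.1.2 := by
  refine Bisimilar.of_map (fun x : (KModel.amalgam P p M N).W => x.1.2) ?_ ?_ ?_ x
  · intro x q hq
    by_cases hqP : q ∈ P
    · simpa [KModel.amalgam, hqP] using x.2.val_iff ⟨hqP, hq⟩
    · simp [KModel.amalgam, hqP]
  · exact fun x x' h => h.2
  · intro x v hv
    obtain ⟨y, hy, hyv⟩ := x.2.back hv
    exact ⟨⟨(y, v), hyv⟩, ⟨hy, hv⟩, rfl⟩

/-- The semantics of `∃̃p` may equivalently require agreement on all letters other than `p`. -/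
theorem exqSat_iff_compl (p : V) (φ : MForm V) (M : KModel V) (X : Set M.W) :
    exqSat p φ M X ↔
      ∃ (M' : KModel V) (X' : Set M'.W), TeamBisim {p}ᶜ M' X' M X ∧ MSat M' X' φ := by
  constructor
  · rintro ⟨M', X', h, hX'⟩
    refine ⟨KModel.amalgam (mletters φ) p M' M, {x | x.1.1 ∈ X' ∧ x.1.2 ∈ X},
      ⟨fun x hx => ⟨x.1.2, hx.2, bisimilar_amalgam_snd _ p M' M x⟩, fun y hy => ?_⟩,
      MSat.of_teamBisim subset_rfl ⟨fun x hx => ?_, fun x hx =>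
        ⟨x.1.1, hx.1, (bisimilar_amalgam_fst _ p M' M x).symm⟩⟩ hX'⟩
    · obtain ⟨x, hx, hxy⟩ := h.2 y hy
      exact ⟨⟨(x, y), hxy⟩, ⟨hx, hy⟩, bisimilar_amalgam_snd _ p M' M ⟨(x, y), hxy⟩⟩
    · obtain ⟨y, hy, hxy⟩ := h.1 x hx
      exact ⟨⟨(x, y), hxy⟩, ⟨hx, hy⟩, (bisimilar_amalgam_fst _ p M' M ⟨(x, y), hxy⟩).symm⟩
  · rintro ⟨M', X', h, hX'⟩
    exact ⟨M', X', h.mono fun _ hq => hq.2, hX'⟩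

/-- The disjoint union of two Kripke models. -/
def KModel.sum (M N : KModel V) : KModel V where
  W := M.W ⊕ N.W
  R := Sum.LiftRel M.R N.R
  val := Sum.elim M.val N.val

theorem bisimilar_inl (P : Set V) (M N : KModel V) (x : M.W) :
    Bisimilar P M x (M.sum N) (Sum.inl x) := by
  refine Bisimilar.of_map (N := M.sum N) Sum.inl (fun _ _ _ => Iff.rfl)
    (fun _ _ h => Sum.LiftRel.inl h) ?_ x
  rintro x _ (⟨h⟩ | ⟨h⟩)
  exact ⟨_, h, rfl⟩

theorem bisimilar_inr (P : Set V) (M N : KModel V) (x : N.W) :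
    Bisimilar P N x (M.sum N) (Sum.inr x) := by
  refine Bisimilar.of_map (N := M.sum N) Sum.inr (fun _ _ _ => Iff.rfl)
    (fun _ _ h => Sum.LiftRel.inr h) ?_ x
  rintro x _ (⟨h⟩ | ⟨h⟩)
  exact ⟨_, h, rfl⟩

theorem TeamBisim.sum {P : Set V} {M₁ M₂ M : KModel V} {X₁ : Set M₁.W} {X₂ : Set M₂.W}
    {Y₁ Y₂ : Set M.W} (h₁ : TeamBisim P M₁ X₁ M Y₁) (h₂ : TeamBisim P M₂ X₂ M Y₂) :
    TeamBisim P (M₁.sum M₂) (Sum.inl '' X₁ ∪ Sum.inr '' X₂) M (Y₁ ∪ Y₂) := by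
  constructor
  · rintro _ (⟨x, hx, rfl⟩ | ⟨x, hx, rfl⟩)
    · obtain ⟨y, hy, hxy⟩ := h₁.1 x hx
      exact ⟨y, Or.inl hy, (bisimilar_inl P M₁ M₂ x).symm.trans hxy⟩
    · obtain ⟨y, hy, hxy⟩ := h₂.1 x hx
      exact ⟨y, Or.inr hy, (bisimilar_inr P M₁ M₂ x).symm.trans hxy⟩
  · rintro y (hy | hy)
    · obtain ⟨x, hx, hxy⟩ := h₁.2 y hy
      exact ⟨Sum.inl x, Or.inl ⟨x, hx, rfl⟩, (bisimilar_inl P M₁ M₂ x).symm.trans hxy⟩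
    · obtain ⟨x, hx, hxy⟩ := h₂.2 y hy
      exact ⟨Sum.inr x, Or.inr ⟨x, hx, rfl⟩, (bisimilar_inr P M₁ M₂ x).symm.trans hxy⟩

/-- the existential bisimulation quantifier commutes with
`∧ NE`, with `∨` and with `⊗`:
`∃̃p (φ₁ ∧ NE) ≡ (∃̃p φ₁) ∧ NE`, `∃̃p (φ₁ ∨ φ₂) ≡ ∃̃p φ₁ ∨ ∃̃p φ₂`,
`∃̃p (φ₁ ⊗ φ₂) ≡ ∃̃p φ₁ ⊗ ∃̃p φ₂`. -/
theorem exq_commutations {V : Type} (φ₁ φ₂ : MForm V) (p : V) :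
    (∀ (M : KModel V) (X : Set M.W),
      exqSat p (.and φ₁ .ne) M X ↔ (exqSat p φ₁ M X ∧ X ≠ ∅)) ∧
    (∀ (M : KModel V) (X : Set M.W),
      exqSat p (.or φ₁ φ₂) M X ↔ (exqSat p φ₁ M X ∨ exqSat p φ₂ M X)) ∧
    (∀ (M : KModel V) (X : Set M.W),
      exqSat p (.tens φ₁ φ₂) M X ↔
        ∃ X₁ X₂, X = X₁ ∪ X₂ ∧ exqSat p φ₁ M X₁ ∧ exqSat p φ₂ M X₂) := by
  simp only [exqSat_iff_compl]
  refine ⟨fun M X => ⟨?_, ?_⟩, fun M X => ⟨?_, ?_⟩, fun M X => ⟨?_, ?_⟩⟩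
  · rintro ⟨M', X', h, hφ, hne⟩
    exact ⟨⟨M', X', h, hφ⟩, mt h.eq_empty_iff.2 hne⟩
  · rintro ⟨⟨M', X', h, hφ⟩, hne⟩
    exact ⟨M', X', h, hφ, mt h.eq_empty_iff.1 hne⟩
  · rintro ⟨M', X', h, hφ | hφ⟩
    · exact Or.inl ⟨M', X', h, hφ⟩
    · exact Or.inr ⟨M', X', h, hφ⟩
  · rintro (⟨M', X', h, hφ⟩ | ⟨M', X', h, hφ⟩)
    · exact ⟨M', X', h, Or.inl hφ⟩
    · exact ⟨M', X', h, Or.inr hφ⟩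
  · rintro ⟨M', _, h, X₁, X₂, rfl, h₁, h₂⟩
    obtain ⟨Y₁, Y₂, rfl, hY₁, hY₂⟩ := h.exists_union
    exact ⟨Y₁, Y₂, rfl, ⟨M', X₁, hY₁, h₁⟩, ⟨M', X₂, hY₂, h₂⟩⟩
  · rintro ⟨Y₁, Y₂, rfl, ⟨M₁, X₁, hY₁, h₁⟩, ⟨M₂, X₂, hY₂, h₂⟩⟩
    exact ⟨M₁.sum M₂, _, hY₁.sum hY₂, _, _, rfl,
      h₁.of_teamBisim subset_rfl (TeamBisim.image (bisimilar_inl _ M₁ M₂) X₁),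
      h₂.of_teamBisim subset_rfl (TeamBisim.image (bisimilar_inr _ M₁ M₂) X₂)⟩
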